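/- arXiv:2106.01990 — 2 statements merged into one kernel-verified Lean document; each statement's English description precedes it below -/
import Mathlib

section
/- Given formal distributions a(z), b(z) with coefficients in a Lie superalgebra g, a(z) and b(z) are local (i.e. (z-w)^N [a(z),b(w)] = 0 for some N ≫ 0) if and only if [a(z),b(w)] can be written as a finite sum Σ_j (a(w)_(j) b(w)) (∂_w^j / j!) δ(z-w), where (a(w)_(j) b(w)) = Res_z (z-w)^j [a(z),b(w)] and δ(z-w) = z^{-1} Σ_{n∈Z} (w/z)^n. -/
/-!
STATEMENT 6: two `g`-valued formal distributions `a(z) = Σ aₙ z^{-n-1}`,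
`b(w) = Σ bₘ w^{-m-1}` are local (i.e. `(z-w)^N [a(z),b(w)] = 0` for some `N ≫ 0`)
iff `[a(z),b(w)] = Σⱼ (a(w)₍ⱼ₎b(w)) (∂_w^j/j!) δ(z-w)` (finite sum), where
`(a(w)₍ⱼ₎b(w)) = Res_z (z-w)^j [a(z),b(w)]` and `δ(z-w) = z⁻¹ Σₙ (w/z)ⁿ`.

A formal distribution in `z, w` is encoded by its coefficients: `c : ℤ × ℤ → g`,
`c (m, n)` being the coefficient of `z^{-m-1} w^{-n-1}`. Multiplication by `(z-w)`
becomes the operator `zw`, and the coefficient of `z^{-m-1}w^{-n-1}` in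
`d(w) (∂_w^j/j!) δ(z-w)` is `C(m,j) d_{m+n-j}` (generalized binomial coefficient).
-/

/-- multiplication of a two-variable formal distribution by `(z - w)`,
at the level of coefficients. -/
def zwMul {g : Type*} [AddCommGroup g] (c : ℤ × ℤ → g) : ℤ × ℤ → g :=
  fun p => c (p.1 + 1, p.2) - c (p.1, p.2 + 1)

/-- the generalized binomial coefficient `C(m, j)` for `m ∈ ℂ`. -/
noncomputable def genChoose (m : ℂ) (j : ℕ) : ℂ :=
  (∏ r ∈ Finset.range j, (m - r)) / (j.factorial : ℂ)

/-- the coefficients of the `j`-th product `(a(w)₍ⱼ₎ b(w)) = Res_z (z-w)^j [a(z),b(w)]`. -/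
def jprodCoeff {g : Type*} [AddCommGroup g] (c : ℤ × ℤ → g) (j : ℕ) (n : ℤ) : g :=
  (zwMul^[j] c) (0, n)

theorem genChoose_zero_right (m : ℂ) : genChoose m 0 = 1 := by
  simp [genChoose]

theorem genChoose_zero_succ (j : ℕ) : genChoose 0 (j + 1) = 0 := by
  simp [genChoose, Finset.prod_range_succ']

theorem genChoose_add_one_succ (m : ℂ) (j : ℕ) :
    genChoose (m + 1) (j + 1) = genChoose m (j + 1) + genChoose m j := by
  have hj : (j.factorial : ℂ) ≠ 0 := by exact_mod_cast j.factorial_ne_zero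
  have hj' : (j : ℂ) + 1 ≠ 0 := by exact_mod_cast j.succ_ne_zero
  have hprod : ∏ r ∈ Finset.range j, (m + 1 - ((r + 1 : ℕ) : ℂ)) =
      ∏ r ∈ Finset.range j, (m - r) :=
    Finset.prod_congr rfl fun r _ => by push_cast; ring
  unfold genChoose
  rw [Finset.prod_range_succ', hprod, Finset.prod_range_succ, Nat.factorial_succ]
  push_cast
  field_simp
  ring

/-- the coefficients of `Σ_{j < J} d_j(w) (∂_w^j/j!) δ(z-w)`. -/
noncomputable def deltaExpansion {g : Type*} [AddCommGroup g] [Module ℂ g]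
    (J : ℕ) (d : ℕ → ℤ → g) : ℤ × ℤ → g :=
  fun p => ∑ j ∈ Finset.range J, genChoose (p.1 : ℂ) j • d j (p.1 + p.2 - j)

theorem zwMul_deltaExpansion_succ {g : Type*} [AddCommGroup g] [Module ℂ g]
    (J : ℕ) (d : ℕ → ℤ → g) :
    zwMul (deltaExpansion (J + 1) d) = deltaExpansion J fun j => d (j + 1) := by
  funext ⟨m, n⟩
  simp only [zwMul, deltaExpansion, ← Finset.sum_sub_distrib]
  rw [Finset.sum_range_succ']
  have hidx : m + 1 + n = m + (n + 1) := by ring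
  simp only [hidx, Int.cast_add, Int.cast_one, genChoose_zero_right, sub_self, add_zero]
  refine Finset.sum_congr rfl fun j _ => ?_
  rw [← sub_smul, genChoose_add_one_succ, add_sub_cancel_left]
  congr 2
  push_cast
  ring

theorem zwMul_iterate_deltaExpansion {g : Type*} [AddCommGroup g] [Module ℂ g]
    (J : ℕ) (d : ℕ → ℤ → g) : zwMul^[J] (deltaExpansion J d) = 0 := by
  induction J generalizing d with
  | zero => funext p; simp [deltaExpansion]
  | succ J ih => rw [Function.iterate_succ_apply, zwMul_deltaExpansion_succ, ih]

theorem deltaExpansion_succ_zero_left {g : Type*} [AddCommGroup g] [Module ℂ g]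
    (J : ℕ) (d : ℕ → ℤ → g) (n : ℤ) : deltaExpansion (J + 1) d (0, n) = d 0 n := by
  simp [deltaExpansion, Finset.sum_range_succ', genChoose_zero_right, genChoose_zero_succ]

/-- a two-variable distribution is determined by its product with `z - w` and its residue
in `z`. -/
theorem eq_of_zwMul_eq {g : Type*} [AddCommGroup g] {c e : ℤ × ℤ → g}
    (h : zwMul c = zwMul e) (h0 : ∀ n, c (0, n) = e (0, n)) : c = e := by
  have step (m n : ℤ) : c (m + 1, n) - c (m, n + 1) = e (m + 1, n) - e (m, n + 1) :=
    congrFun h (m, n)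
  have key (m : ℤ) : ∀ n, c (m, n) = e (m, n) := by
    induction m using Int.induction_on with
    | zero => exact h0
    | succ i ih =>
      intro n
      have hs := step i n
      rwa [ih, sub_left_inj] at hs
    | pred i ih =>
      intro n
      have hs := step (-i - 1) (n - 1)
      rwa [sub_add_cancel, sub_add_cancel, ih, sub_right_inj] at hs
  exact funext fun p => key p.1 p.2

theorem eq_deltaExpansion_of_zwMul_iterate_eq_zero {g : Type*} [AddCommGroup g] [Module ℂ g]
    (N : ℕ) (c : ℤ × ℤ → g) (h : zwMul^[N] c = 0) :
    c = deltaExpansion N (jprodCoeff c) := by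
  induction N generalizing c with
  | zero => funext p; simpa [deltaExpansion] using congrFun h p
  | succ N ih =>
    refine eq_of_zwMul_eq ?_ fun n => ?_
    · rw [zwMul_deltaExpansion_succ]
      exact ih (zwMul c) h
    · rw [deltaExpansion_succ_zero_left]
      rfl

theorem local_iff_delta_expansion {g : Type*} [LieRing g] [LieAlgebra ℂ g]
    (a b : ℤ → g) :
    (∃ N : ℕ, zwMul^[N] (fun p : ℤ × ℤ => ⁅a p.1, b p.2⁆) = 0) ↔
    (∃ J : ℕ, ∀ m n : ℤ,
      ⁅a m, b n⁆ =
        ∑ j ∈ Finset.range J,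
          genChoose (m : ℂ) j •
            jprodCoeff (fun p : ℤ × ℤ => ⁅a p.1, b p.2⁆) j (m + n - j)) := by
  constructor
  · rintro ⟨N, hN⟩
    exact ⟨N, fun m n => congrFun (eq_deltaExpansion_of_zwMul_iterate_eq_zero N _ hN) (m, n)⟩
  · rintro ⟨J, hJ⟩
    refine ⟨J, ?_⟩
    have hc : (fun p : ℤ × ℤ => ⁅a p.1, b p.2⁆) =
        deltaExpansion J (jprodCoeff fun p : ℤ × ℤ => ⁅a p.1, b p.2⁆) :=
      funext fun p => hJ p.1 p.2
    rw [hc]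
    exact zwMul_iterate_deltaExpansion J _
end

section
/- Let m⃗ ∈ Ind(F) be a highest weight singular vector for g = A(CK_6) ≅ E(1,6) with T(m⃗) = Σ_{k=0}^{N} Θ^k Σ_{I∈I_<} η_I ⊗ v_{I,k}. Then v_{I,k} = 0 for all k ≥ 4 and all I with |I| ≤ 5, and v_{*,k} = 0 for k ≥ 5; consequently m⃗ has degree at most 4 in Θ. -/
/-!
STATEMENT 16 (Lemma `lemmagrado4`): let `m⃗ ∈ Ind(F)` be a highest weight singular
vector for `g = A(CK₆) ≅ E(1,6)`, with `T(m⃗) = Σ_{k=0}^N Θᵏ Σ_{I∈I_<} η_I ⊗ v_{I,k}`.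
Then `v_{I,k} = 0` for all `k ≥ 4` and `|I| ≤ 5`, and `v_{*,k} = 0` for `k ≥ 5`;
consequently `m⃗` has degree at most `4` in `Θ`.

Everything is explicit: `Ind(F) ≅ ℂ[Θ] ⊗ Λ(6) ⊗ F` is encoded as finitely supported
functions on `ℕ × Finset (Fin 6)` with values in `F`; `T` is the Hodge-duality
isomorphism; "singular" is expressed by the conditions S1–S3 on `T(m⃗)` via the dual
λ-action of Proposition `actiondualck6`; and "highest weight" is condition S0:
the positive-root vectors `E_{ε_l±ε_j} ∈ N_{so₆} ⊂ g₀` annihilate `m⃗`.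
-/

open Finset in
/-- Koszul inversion count. -/
def invCount (s u : Finset (Fin 6)) : ℕ :=
  ((s ×ˢ u).filter fun p => p.2 < p.1).card

/-- the Grassmann algebra `Λ(6)` (equivalently, the span of the `η`-monomials),
with basis indexed by `Finset (Fin 6)`. -/
abbrev E6 := Finset (Fin 6) →₀ ℂ

/-- the signed (Grassmann) product. -/
noncomputable def emul (x y : E6) : E6 :=
  x.sum fun s a => y.sum fun u b =>
    if Disjoint s u then Finsupp.single (s ∪ u) (a * b * (-1 : ℂ) ^ invCount s u) else 0

/-- the basis monomial `ξ_s` (equivalently `η_s`). -/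
noncomputable def xiF (s : Finset (Fin 6)) : E6 := Finsupp.single s 1

/-- the odd derivation `∂_i`. -/
noncomputable def dE (i : Fin 6) (x : E6) : E6 :=
  x.sum fun s a =>
    if i ∈ s then
      Finsupp.single (s.erase i) (a * (-1 : ℂ) ^ (s.filter (· < i)).card)
    else 0

variable {F : Type*} [AddCommGroup F] [Module ℂ F]

/-- `Ind(F) ≅ ℂ[Θ] ⊗ Λ(6) ⊗ F`: the vector `Σ Θᵏ η_I ⊗ v_{I,k}` is encoded by
`(k, I) ↦ v_{I,k}`. -/
abbrev IndF (F : Type*) [AddCommGroup F] [Module ℂ F] := (ℕ × Finset (Fin 6)) →₀ F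

/-- `e ⊗ v` placed at `Θ`-degree `k`, for `e ∈ Λ(6)`. -/
noncomputable def emb (e : E6) (k : ℕ) (v : F) : IndF F :=
  e.sum fun s c => Finsupp.single (k, s) (c • v)

/-- multiplication by `Θᵐ`. -/
noncomputable def shiftTheta (m : ℕ) (x : IndF F) : IndF F :=
  Finsupp.mapDomain (fun q => (q.1 + m, q.2)) x

/-- the sign of Proposition `actiondualck6`: `(-1)^{|L|(|L|+1)/2 + |L||I|}`. -/
noncomputable def sgnLI (L I : Finset (Fin 6)) : ℂ :=
  (-1 : ℂ) ^ (L.card * (L.card + 1) / 2 + L.card * I.card)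

/-- coefficient of `λ⁰` in `T ∘ (ξ_L)_λ ∘ T⁻¹` applied to `η_I ⊗ v` (Proposition
`actiondualck6`):
`sgn • [ (|L|-2) Θ (ξ_L ⋆ η_I) ⊗ v - (-1)^{|L|} Σᵢ (∂ᵢξ_L ⋆ ∂ᵢη_I) ⊗ v
  - Σ_{r<s} (∂_{rs}ξ_L ⋆ η_I) ⊗ ξ_{sr}.v ]`. -/
noncomputable def dualCoef0 (xact : Fin 6 → Fin 6 → Module.End ℂ F)
    (L I : Finset (Fin 6)) (v : F) : IndF F :=
  sgnLI L I •
    ( ((L.card : ℂ) - 2) • emb (emul (xiF L) (xiF I)) 1 v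
      - ((-1 : ℂ) ^ L.card) •
          ∑ i : Fin 6, emb (emul (dE i (xiF L)) (dE i (xiF I))) 0 v
      - ∑ r : Fin 6, ∑ s : Fin 6,
          if r < s then emb (emul (dE r (dE s (xiF L))) (xiF I)) 0 (xact s r v) else 0 )

/-- coefficient of `λ¹`:
`sgn • [ (ξ_L ⋆ η_I) ⊗ t.v - (-1)^{|L|} Σᵢ ∂ᵢ(ξ_{Li} ⋆ η_I) ⊗ v
  + (-1)^{|L|} Σ_{i≠j} (∂ᵢξ_{Lj} ⋆ η_I) ⊗ ξ_{ji}.v ]`. -/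
noncomputable def dualCoef1 (tact : Module.End ℂ F)
    (xact : Fin 6 → Fin 6 → Module.End ℂ F)
    (L I : Finset (Fin 6)) (v : F) : IndF F :=
  sgnLI L I •
    ( emb (emul (xiF L) (xiF I)) 0 (tact v)
      - ((-1 : ℂ) ^ L.card) •
          ∑ i : Fin 6, emb (dE i (emul (emul (xiF L) (xiF {i})) (xiF I))) 0 v
      + ((-1 : ℂ) ^ L.card) •
          ∑ i : Fin 6, ∑ j : Fin 6,
            if i ≠ j then emb (emul (dE i (emul (xiF L) (xiF {j}))) (xiF I)) 0 (xact j i v)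
            else 0 )

/-- coefficient of `λ²`: `sgn • [ - Σ_{i<j} (ξ_{Lij} ⋆ η_I) ⊗ ξ_{ji}.v ]`. -/
noncomputable def dualCoef2 (xact : Fin 6 → Fin 6 → Module.End ℂ F)
    (L I : Finset (Fin 6)) (v : F) : IndF F :=
  sgnLI L I •
    ( - ∑ i : Fin 6, ∑ j : Fin 6,
        if i < j then
          emb (emul (emul (emul (xiF L) (xiF {i})) (xiF {j})) (xiF I)) 0 (xact j i v)
        else 0 )

/-- the three λ-coefficients above, bundled. -/
noncomputable def dualCoef (tact : Module.End ℂ F)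
    (xact : Fin 6 → Fin 6 → Module.End ℂ F)
    (d : ℕ) (L I : Finset (Fin 6)) (v : F) : IndF F :=
  if d = 0 then dualCoef0 xact L I v
  else if d = 1 then dualCoef1 tact xact L I v
  else if d = 2 then dualCoef2 xact L I v
  else 0

/-- the coefficient of `λᵖ` in `T ∘ (ξ_L)_λ ∘ T⁻¹` applied to
`w = Σ Θᵏ η_I ⊗ v_{I,k}`, using Proposition `actiondualck6` together with
Lemma `lambda+thetack6`: `(ξ_L)_λ (Θᵏ ξ_I ⊗ v) = (Θ+λ)ᵏ ((ξ_L)_λ (ξ_I ⊗ v))`. -/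
noncomputable def dualAct (tact : Module.End ℂ F)
    (xact : Fin 6 → Fin 6 → Module.End ℂ F)
    (L : Finset (Fin 6)) (w : IndF F) (p : ℕ) : IndF F :=
  w.sum fun kI v =>
    ∑ d ∈ Finset.range 3,
      if d ≤ p ∧ p - d ≤ kI.1 then
        (kI.1.choose (p - d) : ℂ) •
          shiftTheta (kI.1 - (p - d)) (dualCoef tact xact d L kI.2 v)
      else 0

/-- the coefficient of `λᵖ` in
`T((ξ_L)_λ m) - i (-1)^{|L|(|L|+1)/2} λ^{3-|L|} T((ξ_L^*)_λ m)` (for `|L| ≤ 3`),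
where `w = T(m)` and `ξ_L^* = (-1)^{invCount L Lᶜ} ξ_{Lᶜ}` is the modified Hodge dual. -/
noncomputable def singCond (tact : Module.End ℂ F)
    (xact : Fin 6 → Fin 6 → Module.End ℂ F)
    (L : Finset (Fin 6)) (w : IndF F) (p : ℕ) : IndF F :=
  dualAct tact xact L w p
    - (Complex.I * (-1 : ℂ) ^ (L.card * (L.card + 1) / 2) *
        (-1 : ℂ) ^ invCount L Lᶜ) •
      (if 3 - L.card ≤ p then dualAct tact xact Lᶜ w (p - (3 - L.card)) else 0)

/-- `m` (with `w = T(m)`) is a singular vector: conditions S1, S2, S3. -/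
def IsSingular (tact : Module.End ℂ F)
    (xact : Fin 6 → Fin 6 → Module.End ℂ F) (w : IndF F) : Prop :=
  ∀ L : Finset (Fin 6), L.card ≤ 3 →
    -- S1 (`0 ≤ |L| ≤ 3`): the second `λ`-derivative vanishes:
    (∀ p : ℕ, 2 ≤ p → singCond tact xact L w p = 0) ∧
    -- S2 (`1 ≤ |L| ≤ 3`): the first `λ`-derivative at `λ = 0` vanishes:
    (1 ≤ L.card → singCond tact xact L w 1 = 0) ∧
    -- S3 (`|L| = 3`): the value at `λ = 0` vanishes:
    (L.card = 3 → singCond tact xact L w 0 = 0)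

/-- the Hodge-duality isomorphism `T : Θᵏ η_I ⊗ v ↦ Θᵏ η̄_I ⊗ v`,
`η̄_I = (-1)^{invCount Iᶜ I} η_{Iᶜ}`. -/
noncomputable def Tmap (m : IndF F) : IndF F :=
  m.sum fun q v => Finsupp.single (q.1, q.2ᶜ) (((-1 : ℂ) ^ invCount q.2ᶜ q.2) • v)

/-- the hypotheses making `F` a finite-dimensional irreducible `g_{≥0} = g₀ ⊕ g_{>0}`-module
with `g_{>0}` acting trivially: `tact` is the action of the grading element `t` and
`xact i j` that of `ξ_{ij} ∈ so(6)`. -/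
structure IsG0Module (F : Type*) [AddCommGroup F] [Module ℂ F]
    (tact : Module.End ℂ F) (xact : Fin 6 → Fin 6 → Module.End ℂ F) : Prop where
  finiteDim : FiniteDimensional ℂ F
  skew : ∀ i j : Fin 6, xact i j = -xact j i
  t_central : ∀ i j : Fin 6, tact * xact i j = xact i j * tact
  so6_rel : ∀ a b c d : Fin 6,
    xact a b * xact c d - xact c d * xact a b =
      (if a = c then xact b d else 0) - (if a = d then xact b c else 0)
        - (if b = c then xact a d else 0) + (if b = d then xact a c else 0)
  irreducible : ∀ W : Submodule ℂ F,
    (∀ v ∈ W, tact v ∈ W) → (∀ i j : Fin 6, ∀ v ∈ W, xact i j v ∈ W) → W = ⊥ ∨ W = ⊤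
  nontriv : Nontrivial F

/-- the even derivation `[ξ_{ab}, -]` on `η`-monomials: `[ξ_{ab}, η_a] = η_b`,
`[ξ_{ab}, η_b] = -η_a`, `[ξ_{ab}, η_i] = 0` otherwise. -/
noncomputable def mDer (a b : Fin 6) (e : E6) : E6 :=
  e.sum fun s c =>
    (if a ∈ s ∧ b ∉ s.erase a then
      Finsupp.single (insert b (s.erase a))
        (c * (-1 : ℂ) ^ (((s.erase a).filter (· < a)).card
            + ((s.erase a).filter (· < b)).card))
    else 0)
    - (if b ∈ s ∧ a ∉ s.erase b then
      Finsupp.single (insert a (s.erase b))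
        (c * (-1 : ℂ) ^ (((s.erase b).filter (· < b)).card
            + ((s.erase b).filter (· < a)).card))
    else 0)

/-- the action of `ξ_{ab} ∈ g₀` on `Ind(F)`:
`ξ_{ab}.(Θᵏ η_I ⊗ v) = Θᵏ [ξ_{ab}, η_I] ⊗ v + Θᵏ η_I ⊗ ξ_{ab}.v`. -/
noncomputable def xiOn {F : Type*} [AddCommGroup F] [Module ℂ F]
    (xact : Fin 6 → Fin 6 → Module.End ℂ F) (a b : Fin 6) (m : IndF F) : IndF F :=
  m.sum fun q v => emb (mDer a b (xiF q.2)) q.1 v + Finsupp.single q (xact a b v)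

/-- the index `n` (0-based) as an element of `Fin 6`. -/
def idx (n : ℕ) : Fin 6 := ⟨n % 6, Nat.mod_lt _ (by norm_num)⟩

/-- the action on `Ind(F)` of the positive root vector
`E_{ε_l-ε_j} = -ξ_{2l-1,2j-1} - ξ_{2l,2j} - i ξ_{2l-1,2j} + i ξ_{2l,2j-1}`
(1-based indices). -/
noncomputable def EminusOn {F : Type*} [AddCommGroup F] [Module ℂ F]
    (xact : Fin 6 → Fin 6 → Module.End ℂ F) (l j : ℕ) (m : IndF F) : IndF F :=
  -(xiOn xact (idx (2 * l - 2)) (idx (2 * j - 2)) m)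
    - xiOn xact (idx (2 * l - 1)) (idx (2 * j - 1)) m
    - Complex.I • xiOn xact (idx (2 * l - 2)) (idx (2 * j - 1)) m
    + Complex.I • xiOn xact (idx (2 * l - 1)) (idx (2 * j - 2)) m

/-- the action on `Ind(F)` of the positive root vector
`E_{ε_l+ε_j} = -ξ_{2l-1,2j-1} + ξ_{2l,2j} + i ξ_{2l-1,2j} + i ξ_{2l,2j-1}`. -/
noncomputable def EplusOn {F : Type*} [AddCommGroup F] [Module ℂ F]
    (xact : Fin 6 → Fin 6 → Module.End ℂ F) (l j : ℕ) (m : IndF F) : IndF F :=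
  -(xiOn xact (idx (2 * l - 2)) (idx (2 * j - 2)) m)
    + xiOn xact (idx (2 * l - 1)) (idx (2 * j - 1)) m
    + Complex.I • xiOn xact (idx (2 * l - 2)) (idx (2 * j - 1)) m
    + Complex.I • xiOn xact (idx (2 * l - 1)) (idx (2 * j - 2)) m

theorem shiftTheta_apply (m : ℕ) (x : IndF F) (n : ℕ) (s : Finset (Fin 6)) :
    shiftTheta m x (n, s) = if m ≤ n then x (n - m, s) else 0 := by
  have hinj : Function.Injective fun q : ℕ × Finset (Fin 6) => (q.1 + m, q.2) := by
    rintro ⟨a, b⟩ ⟨c, d⟩ h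
    simpa using h
  unfold shiftTheta
  split_ifs with h
  · obtain ⟨r, rfl⟩ := Nat.exists_eq_add_of_le' h
    simpa using Finsupp.mapDomain_apply hinj x (r, s)
  · refine Finsupp.mapDomain_of_notMem_range _ _ ?_
    rintro ⟨⟨a, b⟩, hab⟩
    simp only [Prod.mk.injEq] at hab
    omega

theorem emb_apply (e : E6) (k : ℕ) (v : F) (n : ℕ) (s : Finset (Fin 6)) :
    emb e k v (n, s) = if n = k then e s • v else 0 := by
  unfold emb
  rw [Finsupp.sum, Finsupp.finsetSum_apply]
  simp only [Finsupp.single_apply, Prod.mk.injEq]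
  split_ifs with h
  · subst h
    simp only [true_and, Finset.sum_ite_eq', Finsupp.mem_support_iff]
    split_ifs with h0
    · rfl
    · simp [not_not.mp h0]
  · exact Finset.sum_eq_zero fun i _ => if_neg fun hi => h hi.1.symm

theorem dualCoef_apply_eq_zero (tact : Module.End ℂ F) (xact : Fin 6 → Fin 6 → Module.End ℂ F)
    (d : ℕ) (L I : Finset (Fin 6)) (v : F) (n : ℕ) (s : Finset (Fin 6)) (h : 3 ≤ n + d) :
    dualCoef tact xact d L I v (n, s) = 0 := by
  have hemb : ∀ (c : Prop) [Decidable c] (e : E6) (k : ℕ) (u : F), n ≠ k →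
      (if c then emb e k u else 0 : IndF F) (n, s) = 0 := by
    intro c _ e k u hk
    split_ifs
    · rw [emb_apply, if_neg hk]
    · rfl
  unfold dualCoef
  split_ifs with h0 h1 h2
  · have hn0 : n ≠ 0 := by omega
    have hn1 : n ≠ 1 := by omega
    simp [dualCoef0, emb_apply, hemb, hn0, hn1]
  · have hn0 : n ≠ 0 := by omega
    simp only [dualCoef1, Finsupp.smul_apply, Finsupp.add_apply, Finsupp.sub_apply, emb_apply,
      Finsupp.finsetSum_apply, hemb _ _ _ _ hn0, if_neg hn0]
    simp
  · have hn0 : n ≠ 0 := by omega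
    simp only [dualCoef2, Finsupp.smul_apply, Finsupp.neg_apply,
      Finsupp.finsetSum_apply, hemb _ _ _ _ hn0]
    simp
  · rfl

theorem dualAct_apply (tact : Module.End ℂ F) (xact : Fin 6 → Fin 6 → Module.End ℂ F)
    (L : Finset (Fin 6)) (w : IndF F) (p n : ℕ) (s : Finset (Fin 6)) :
    dualAct tact xact L w p (n, s) =
      ∑ q ∈ w.support, ∑ d ∈ Finset.range 3,
        if d ≤ p ∧ p - d ≤ q.1 then
          (q.1.choose (p - d) : ℂ) •
            (if q.1 - (p - d) ≤ n then
              dualCoef tact xact d L q.2 (w q) (n - (q.1 - (p - d)), s) else 0)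
        else 0 := by
  unfold dualAct
  rw [Finsupp.sum, Finsupp.finsetSum_apply]
  refine Finset.sum_congr rfl fun q _ => ?_
  rw [Finsupp.finsetSum_apply]
  refine Finset.sum_congr rfl fun d _ => ?_
  split_ifs with h h' <;> simp_all [shiftTheta_apply]

/-- The coefficient of total degree `T` of `λᵈ (Θ + λ)ᵏ c(Θ)` at `λ = -1`, `Θ = 1`. -/
theorem alternating_sum_binomial_shift (c : ℕ → F) (k d T : ℕ) (hd : d < 3) (hT : 3 ≤ T)
    (hc : ∀ n, 3 ≤ n + d → c n = 0) :
    ∑ p ∈ Finset.range (T + 1), (-1 : ℂ) ^ p •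
      (if d ≤ p ∧ p - d ≤ k then
        (k.choose (p - d) : ℂ) •
          (if k - (p - d) ≤ T - p then c (T - p - (k - (p - d))) else 0)
      else 0) = 0 := by
  by_cases hk : k + d ≤ T
  · have hterm : ∀ p ∈ Finset.range (T + 1), (-1 : ℂ) ^ p •
        (if d ≤ p ∧ p - d ≤ k then
          (k.choose (p - d) : ℂ) •
            (if k - (p - d) ≤ T - p then c (T - p - (k - (p - d))) else 0)
        else 0) =
        (if d ≤ p ∧ p - d ≤ k then (-1 : ℂ) ^ p * (k.choose (p - d) : ℂ) else 0) •
          c (T - d - k) := by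
      intro p hp
      have hp' := Finset.mem_range.mp hp
      split_ifs with h1 h2
      · rw [smul_smul, show T - p - (k - (p - d)) = T - d - k by omega]
      · omega
      · simp
    rw [Finset.sum_congr rfl hterm, ← Finset.sum_smul]
    rcases Nat.eq_zero_or_pos k with rfl | hkpos
    · rw [hc _ (by omega), smul_zero]
    · convert zero_smul ℂ (c (T - d - k))
      rw [← Finset.sum_filter]
      have hset : (Finset.range (T + 1)).filter (fun p => d ≤ p ∧ p - d ≤ k)
          = Finset.Ico d (d + (k + 1)) := by
        ext p
        simp only [Finset.mem_filter, Finset.mem_range, Finset.mem_Ico]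
        omega
      rw [hset, Finset.sum_Ico_eq_sum_range]
      have halt := congrArg (Int.cast : ℤ → ℂ)
        (Int.alternating_sum_range_choose_of_ne hkpos.ne')
      push_cast at halt
      simp only [add_tsub_cancel_left, pow_add, mul_assoc, ← Finset.mul_sum, halt, mul_zero]
  · refine Finset.sum_eq_zero fun p hp => ?_
    have hp' := Finset.mem_range.mp hp
    split_ifs with h1 h2
    · omega
    · simp
    · simp

theorem alternating_sum_dualAct (tact : Module.End ℂ F)
    (xact : Fin 6 → Fin 6 → Module.End ℂ F) (L : Finset (Fin 6)) (w : IndF F) (T : ℕ)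
    (hT : 3 ≤ T) (s : Finset (Fin 6)) :
    ∑ p ∈ Finset.range (T + 1), (-1 : ℂ) ^ p • dualAct tact xact L w p (T - p, s) = 0 := by
  simp only [dualAct_apply, Finset.smul_sum]
  rw [Finset.sum_comm]
  refine Finset.sum_eq_zero fun q _ => ?_
  rw [Finset.sum_comm]
  refine Finset.sum_eq_zero fun d hd => ?_
  exact alternating_sum_binomial_shift (fun n => dualCoef tact xact d L q.2 (w q) (n, s))
    q.1 d T (Finset.mem_range.mp hd) hT fun n hn => dualCoef_apply_eq_zero _ _ _ _ _ _ _ _ hn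

theorem dualAct_singleton_zero_apply_eq_zero {tact : Module.End ℂ F}
    {xact : Fin 6 → Fin 6 → Module.End ℂ F} {w : IndF F} (hw : IsSingular tact xact w)
    (i : Fin 6) (T : ℕ) (hT : 5 ≤ T) (s : Finset (Fin 6)) :
    dualAct tact xact {i} w 0 (T, s) = 0 := by
  obtain ⟨hS1, hS2, -⟩ := hw {i} (by simp)
  have hpos : ∀ p, 1 ≤ p → singCond tact xact {i} w p = 0 := by
    intro p hp
    rcases hp.eq_or_lt with rfl | hp
    · exact hS2 (by simp)
    · exact hS1 p hp
  have hsum : ∑ p ∈ Finset.range (T + 1),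
      (-1 : ℂ) ^ p • singCond tact xact {i} w p (T - p, s) = 0 := by
    simp only [singCond, Finsupp.sub_apply, Finsupp.smul_apply, smul_sub, Finset.sum_sub_distrib]
    rw [alternating_sum_dualAct _ _ _ _ _ (by omega), zero_sub, neg_eq_zero]
    simp only [smul_comm ((-1 : ℂ) ^ _) (_ * _ : ℂ), ← Finset.smul_sum]
    convert smul_zero _
    obtain ⟨r, rfl⟩ := Nat.exists_eq_add_of_le' (show 2 ≤ T by omega)
    rw [Finset.sum_range_succ', Finset.sum_range_succ']
    have h := alternating_sum_dualAct tact xact {i}ᶜ w r (by omega) s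
    simpa [pow_succ, add_assoc] using h
  rw [Finset.sum_range_succ', Finset.sum_eq_zero fun p _ => by
    rw [hpos (p + 1) (by omega)]; simp] at hsum
  simpa [singCond] using hsum

theorem emul_xiF (s u : Finset (Fin 6)) :
    emul (xiF s) (xiF u) =
      if Disjoint s u then Finsupp.single (s ∪ u) ((-1 : ℂ) ^ invCount s u) else 0 := by
  simp [emul, xiF, -Finsupp.single_mul]

theorem dE_xiF (i : Fin 6) (s : Finset (Fin 6)) :
    dE i (xiF s) =
      if i ∈ s then Finsupp.single (s.erase i) ((-1 : ℂ) ^ (s.filter (· < i)).card) else 0 := by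
  simp [dE, xiF, -Finsupp.single_mul]

theorem dE_zero (i : Fin 6) : dE i 0 = 0 := by
  simp [dE]

theorem emul_zero_left (x : E6) : emul 0 x = 0 := by
  simp [emul]

theorem emul_xiF_empty_left (x : E6) : emul (xiF ∅) x = x := by
  simp [emul, xiF, invCount, -Finsupp.single_mul]

theorem emb_zero_left (k : ℕ) (v : F) : emb 0 k v = 0 := by
  simp [emb]

theorem dE_xiF_singleton (i j : Fin 6) :
    dE j (xiF {i}) = if j = i then xiF ∅ else 0 := by
  rw [dE_xiF]
  by_cases h : j = i
  · subst h
    simp [xiF, Finset.filter_singleton]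
  · simp [h]

theorem dE_xiF_empty (i : Fin 6) : dE i (xiF ∅) = 0 := by
  simp [dE_xiF]

theorem dualCoef0_singleton (xact : Fin 6 → Fin 6 → Module.End ℂ F) (i : Fin 6)
    (I : Finset (Fin 6)) (v : F) :
    dualCoef0 xact {i} I v = sgnLI {i} I •
      (emb (dE i (xiF I)) 0 v - emb (emul (xiF {i}) (xiF I)) 1 v) := by
  have hfst : ∑ j : Fin 6, emb (emul (dE j (xiF {i})) (dE j (xiF I))) 0 v
      = emb (dE i (xiF I)) 0 v := by
    rw [Finset.sum_eq_single i]
    · rw [dE_xiF_singleton, if_pos rfl, emul_xiF_empty_left]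
    · intro j _ hj
      rw [dE_xiF_singleton, if_neg hj, emul_zero_left, emb_zero_left]
    · simp
  have hsnd : ∀ r s : Fin 6, dE r (dE s (xiF {i})) = 0 := by
    intro r s
    rw [dE_xiF_singleton]
    split_ifs
    · exact dE_xiF_empty r
    · exact dE_zero r
  unfold dualCoef0
  rw [hfst]
  simp only [hsnd, emul_zero_left, emb_zero_left, ite_self, Finset.sum_const_zero, sub_zero,
    Finset.card_singleton]
  congr 1
  norm_num
  abel

theorem dualAct_singleton_zero_apply (tact : Module.End ℂ F)
    (xact : Fin 6 → Fin 6 → Module.End ℂ F) (i : Fin 6) (w : IndF F) (T : ℕ)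
    (s : Finset (Fin 6)) :
    dualAct tact xact {i} w 0 (T, s) =
      ∑ q ∈ w.support, sgnLI {i} q.2 •
        ((if q.1 = T then dE i (xiF q.2) s • w q else 0) -
          if q.1 + 1 = T then emul (xiF {i}) (xiF q.2) s • w q else 0) := by
  rw [dualAct_apply]
  refine Finset.sum_congr rfl fun q _ => ?_
  rw [Finset.sum_eq_single 0]
  · simp only [le_refl, Nat.sub_zero, zero_le, and_self, if_true, Nat.choose_zero_right,
      Nat.cast_one, one_smul, dualCoef, dualCoef0_singleton, Finsupp.smul_apply,
      Finsupp.sub_apply, emb_apply]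
    split_ifs <;> first | omega | simp
  · intro d _ hd
    rw [if_neg (by omega)]
  · simp

theorem sgnLI_ne_zero (L I : Finset (Fin 6)) : sgnLI L I ≠ 0 := by
  simp [sgnLI]

theorem IsSingular.apply_eq_zero_of_mem {tact : Module.End ℂ F}
    {xact : Fin 6 → Fin 6 → Module.End ℂ F} {w : IndF F} (hw : IsSingular tact xact w)
    {i : Fin 6} {k : ℕ} (hk : 5 ≤ k) {s : Finset (Fin 6)} (hi : i ∈ s) : w (k, s) = 0 := by
  have h := dualAct_singleton_zero_apply_eq_zero hw i k hk (s.erase i)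
  rw [dualAct_singleton_zero_apply, Finset.sum_eq_single (k, s)] at h
  · simpa [dE_xiF, hi, sgnLI_ne_zero] using h
  · rintro ⟨k', u⟩ - hne
    have hdE : k' = k → dE i (xiF u) (s.erase i) = 0 := by
      rintro rfl
      rw [dE_xiF]
      split_ifs with hu
      · refine Finsupp.single_eq_of_ne fun he => hne ?_
        rw [← Finset.insert_erase hi, he, Finset.insert_erase hu]
      · rfl
    have hemul : emul (xiF {i}) (xiF u) (s.erase i) = 0 := by
      rw [emul_xiF]
      split_ifs
      · refine Finsupp.single_eq_of_ne fun he => Finset.notMem_erase i s ?_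
        rw [he]
        simp
      · rfl
    simp +contextual [hdE, hemul]
  · intro hn
    simp [Finsupp.notMem_support_iff.mp hn]

theorem IsSingular.apply_eq_zero_of_notMem {tact : Module.End ℂ F}
    {xact : Fin 6 → Fin 6 → Module.End ℂ F} {w : IndF F} (hw : IsSingular tact xact w)
    {i : Fin 6} {k : ℕ} (hk : 4 ≤ k) {s : Finset (Fin 6)} (hi : i ∉ s) : w (k, s) = 0 := by
  have h := dualAct_singleton_zero_apply_eq_zero hw i (k + 1) (by omega) (insert i s)
  rw [dualAct_singleton_zero_apply, Finset.sum_eq_single (k, s)] at h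
  · simpa [emul_xiF, hi, sgnLI_ne_zero] using h
  · rintro ⟨k', u⟩ - hne
    have hdE : dE i (xiF u) (insert i s) = 0 := by
      rw [dE_xiF]
      split_ifs
      · refine Finsupp.single_eq_of_ne fun he => Finset.notMem_erase i u ?_
        rw [← he]
        simp
      · rfl
    have hemul : k' = k → emul (xiF {i}) (xiF u) (insert i s) = 0 := by
      rintro rfl
      rw [emul_xiF]
      split_ifs with hu
      · refine Finsupp.single_eq_of_ne fun he => hne ?_
        have hs := Finset.erase_insert hi
        rw [he, ← Finset.insert_eq,
          Finset.erase_insert (Finset.disjoint_singleton_left.mp hu)] at hs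
        rw [hs]
      · rfl
    simp +contextual [hdE, hemul]
  · intro hn
    simp [Finsupp.notMem_support_iff.mp hn]

theorem hw_singular_vector_theta_degree_le_four
    {F : Type*} [AddCommGroup F] [Module ℂ F]
    (tact : Module.End ℂ F) (xact : Fin 6 → Fin 6 → Module.End ℂ F)
    (hF : IsG0Module F tact xact)
    (m : IndF F) (hm : m ≠ 0)
    -- condition S0: `N_{so₆}.m⃗ = 0` (highest weight):
    (hS0 : ∀ l j : ℕ, 1 ≤ l → l < j → j ≤ 3 →
      EminusOn xact l j m = 0 ∧ EplusOn xact l j m = 0)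
    -- conditions S1–S3: `m⃗` is singular:
    (hsing : IsSingular tact xact (Tmap m)) :
    (∀ (k : ℕ) (s : Finset (Fin 6)), 4 ≤ k → s.card ≤ 5 → Tmap m (k, s) = 0) ∧
    (∀ k : ℕ, 5 ≤ k → Tmap m (k, Finset.univ) = 0) ∧
    (∀ (k : ℕ) (s : Finset (Fin 6)), 5 ≤ k → Tmap m (k, s) = 0) := by
  have hlow : ∀ (k : ℕ) (s : Finset (Fin 6)), 4 ≤ k → s.card ≤ 5 → Tmap m (k, s) = 0 := by
    intro k s hk hs
    obtain ⟨i, hi⟩ : ∃ i, i ∉ s := by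
      by_contra! h
      rw [Finset.eq_univ_iff_forall.mpr h] at hs
      simp at hs
    exact hsing.apply_eq_zero_of_notMem hk hi
  have htop : ∀ k : ℕ, 5 ≤ k → Tmap m (k, Finset.univ) = 0 := fun k hk =>
    hsing.apply_eq_zero_of_mem hk (Finset.mem_univ 0)
  refine ⟨hlow, htop, fun k s hk => ?_⟩
  by_cases hs : s = Finset.univ
  · exact hs ▸ htop k hk
  · refine hlow k s (by omega) ?_
    have := (Finset.card_lt_iff_ne_univ s).mpr hs
    simp only [Fintype.card_fin] at this
    omega
end
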